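/- For every T > 0 there exist positive constants c₁ and c₂ such that for all t ∈ (0,T], all x, y ∈ D, and every multi-index a = (a_1,…,a_d) of nonnegative integers with |a| = ∑_i a_i ∈ {1,2}, the spatial derivative ∂_x^a G(x,y,t) exists and satisfies |∂_x^a G(x,y,t)| ≤ c₁ t^{−(d+|a|)/4} exp(−c₂ |x−y|^{4/3} t^{−1/3}). -/

import Mathlib

open MeasureTheory Real Set

noncomputable section

/-- The spatial domain `D = (0,π)^d` as a subset of Euclidean space. -/
def domD (d : ℕ) : Set (EuclideanSpace ℝ (Fin d)) :=
  {x | ∀ i, x i ∈ Set.Ioo (0 : ℝ) π}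

/-- One-dimensional normalized cosine functions: `ε_0 = 1/√π`, `ε_j(x) = √(2/π) cos(jx)`. -/
def eps1 (j : ℕ) (x : ℝ) : ℝ :=
  if j = 0 then 1 / Real.sqrt π else Real.sqrt (2 / π) * Real.cos (j * x)

/-- The product functions `ε_k(x) = ∏ i, ε_{k i}(x i)` for a multi-index `k ∈ ℕ^d`. -/
def epsk {d : ℕ} (k : Fin d → ℕ) (x : EuclideanSpace ℝ (Fin d)) : ℝ :=
  ∏ i, eps1 (k i) (x i)

/-- The eigenvalue `λ_k = ∑ i, k_i²`. -/
def lam {d : ℕ} (k : Fin d → ℕ) : ℝ := ∑ i, (k i : ℝ) ^ 2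

/-- The Green's function of `−Δ²+Δ` with homogeneous Neumann boundary conditions on `D`:
`G(x,y,t) = ∑_{k∈ℕ^d} e^{−(λ_k²+λ_k)t} ε_k(x) ε_k(y)`. -/
def green {d : ℕ} (x y : EuclideanSpace ℝ (Fin d)) (t : ℝ) : ℝ :=
  ∑' k : Fin d → ℕ, Real.exp (-(lam k ^ 2 + lam k) * t) * epsk k x * epsk k y

/-- The partial derivative of `f` in the `i`-th coordinate direction. -/
def pder {d : ℕ} (i : Fin d) (f : EuclideanSpace ℝ (Fin d) → ℝ)
    (x : EuclideanSpace ℝ (Fin d)) : ℝ :=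
  fderiv ℝ f x (EuclideanSpace.single i 1)

theorem norm_iterate_fwdDiff_le {ρ : ℝ} (hρ : 1 < ρ) (N : ℕ) :
    ∀ {f : ℂ → ℂ}, Differentiable ℂ f → ∀ {z : ℂ} {M : ℝ},
      (∀ w : ℂ, ‖w - z‖ ≤ N * ρ → ‖f w‖ ≤ M) → ‖(fwdDiff 1)^[N] f z‖ ≤ (2 / ρ) ^ N * M := by
  induction N with
  | zero =>
    intro f _ z M h
    simpa using h z (by simp)
  | succ N ih =>
    intro f hf z M h
    rw [Function.iterate_succ_apply, pow_succ, mul_assoc]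
    refine ih (by unfold fwdDiff; fun_prop) fun w hw => ?_
    have hfw : ∀ v : ℂ, ‖v - w‖ ≤ ρ → ‖f v‖ ≤ M := fun v hv => h v <| by
      have := norm_sub_le_norm_sub_add_norm_sub v w z
      push_cast
      linarith
    have hmaps : MapsTo f (Metric.ball w ρ) (Metric.closedBall (f w) (2 * M)) := fun v hv => by
      have h₁ := hfw v (by simpa [dist_eq_norm] using (Metric.mem_ball.1 hv).le)
      have h₂ := hfw w (by simp; linarith)
      rw [Metric.mem_closedBall, dist_eq_norm]
      linarith [norm_sub_le (f v) (f w)]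
    have := Complex.dist_le_div_mul_dist_of_mapsTo_ball hf.differentiableOn hmaps
      (z := w + 1) (by simpa [dist_eq_norm] using hρ)
    calc ‖fwdDiff 1 f w‖ ≤ 2 * M / ρ * dist (w + 1) w := by
          simpa [fwdDiff, dist_eq_norm] using this
      _ = 2 / ρ * M := by simp [dist_eq_norm]; ring

/-- Summation by parts: multiplying an exponential series by `(e^{-iz} - 1)^N` takes `N`-th forward
differences of the coefficients. -/
theorem hasSum_iterate_fwdDiff_mul_exp (z : ℝ) (N : ℕ) :
    ∀ {f : ℂ → ℂ}, Summable (fun k : ℤ => ‖f k‖) →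
      HasSum (fun k : ℤ => (fwdDiff 1)^[N] f k * Complex.exp (k * z * Complex.I))
        ((Complex.exp (-(z * Complex.I)) - 1) ^ N *
          ∑' k : ℤ, f k * Complex.exp (k * z * Complex.I)) := by
  have key : ∀ {f : ℂ → ℂ}, Summable (fun k : ℤ => ‖f k‖) →
      Summable (fun k : ℤ => f k * Complex.exp (k * z * Complex.I)) := fun {f} hf => by
    refine .of_norm_bounded hf fun k => ?_
    have := Complex.norm_exp_ofReal_mul_I (k * z)
    push_cast at this
    simp [this]
  induction N with
  | zero => intro f hf; simpa using (key hf).hasSum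
  | succ N ih =>
    intro f hf
    have hshift : Summable (fun k : ℤ => ‖f ((k : ℂ) + 1)‖) := by
      have := (Equiv.addRight (1 : ℤ)).summable_iff.2 hf
      simpa [Function.comp_def] using this
    have hΔ : Summable (fun k : ℤ => ‖fwdDiff 1 f (k : ℂ)‖) :=
      .of_nonneg_of_le (fun _ => norm_nonneg _) (fun k => norm_sub_le _ _) (hshift.add hf)
    simp only [Function.iterate_succ_apply]
    convert ih hΔ using 1
    rw [pow_succ, mul_assoc]
    congr 1
    have h₁ : HasSum (fun k : ℤ => f ((k : ℂ) + 1) * Complex.exp (k * z * Complex.I))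
        (Complex.exp (-(z * Complex.I)) * ∑' k : ℤ, f k * Complex.exp (k * z * Complex.I)) := by
      convert! ((Equiv.addRight (1 : ℤ)).hasSum_iff.2 (key hf).hasSum).mul_left
        (Complex.exp (-(z * Complex.I))) using 2 with k
      rw [Function.comp_apply, mul_left_comm, ← Complex.exp_add]
      simp only [Equiv.coe_addRight, Int.cast_add, Int.cast_one]
      congr 2
      ring
    rw [sub_mul, one_mul, ← (h₁.sub (key hf).hasSum).tsum_eq]
    exact tsum_congr fun k => by simp [fwdDiff]; ring

/-- Decay of an exponential series whose coefficients extend to an entire function that is small on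
a disk of radius `N ρ` around every integer. -/
theorem norm_tsum_mul_exp_le {f : ℂ → ℂ} (hf : Differentiable ℂ f) {ρ z S : ℝ} (hρ : 1 < ρ) (N : ℕ)
    {b : ℤ → ℝ} (hb : HasSum b S)
    (hfb : ∀ (k : ℤ) (w : ℂ), ‖w - k‖ ≤ N * ρ → ‖f w‖ ≤ b k) :
    ‖Complex.exp (-(z * Complex.I)) - 1‖ ^ N *
      ‖∑' k : ℤ, f k * Complex.exp (k * z * Complex.I)‖ ≤ (2 / ρ) ^ N * S := by
  have hsum : Summable (fun k : ℤ => ‖f k‖) :=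
    .of_nonneg_of_le (fun _ => norm_nonneg _)
      (fun k => hfb k k (by simp; positivity)) hb.summable
  rw [← norm_pow, ← norm_mul, ← (hasSum_iterate_fwdDiff_mul_exp z N hsum).tsum_eq]
  refine tsum_of_norm_bounded (hb.mul_left _) fun k => ?_
  have := Complex.norm_exp_ofReal_mul_I (k * z)
  push_cast at this
  rw [norm_mul, this, mul_one]
  exact norm_iterate_fwdDiff_le hρ N hf (hfb k)

/-- The symbol of `∂_x^a exp(-t(Δ²-Δ))`, up to a power of `I`, in one variable `z`,
the other frequencies contributing `m = ∑ k_j²` to the eigenvalue. -/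
def symb (a : ℕ) (m t : ℝ) (z : ℂ) : ℂ :=
  z ^ a * Complex.exp (-((z ^ 2 + m) ^ 2 + (z ^ 2 + m)) * t)

theorem differentiable_symb (a : ℕ) (m t : ℝ) : Differentiable ℂ (symb a m t) := by
  unfold symb; fun_prop

theorem half_sq_le_re_add {A e R κ : ℝ} {v : ℂ} (hκA : κ ^ 2 ≤ A)
    (he : e = 2 * κ * R + R ^ 2) (hv : ‖v‖ ≤ e) :
    A ^ 2 / 2 - 1459 * R ^ 4 - 21 ≤ (((A : ℂ) + v) ^ 2 + (A + v)).re := by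
  have hA : 0 ≤ A := (sq_nonneg κ).trans hκA
  have he₀ : 0 ≤ e := (norm_nonneg v).trans hv
  have hre : -e ≤ v.re := by linarith [neg_abs_le v.re, Complex.abs_re_le_norm v]
  have hsq : v.re ^ 2 + v.im ^ 2 ≤ e ^ 2 := by
    have := Complex.sq_norm v
    rw [Complex.normSq_apply] at this
    nlinarith [norm_nonneg v]
  have heA : e ≤ A / 8 + 9 * R ^ 2 := by nlinarith [sq_nonneg (κ - 8 * R)]
  have hexp : (((A : ℂ) + v) ^ 2 + (A + v)).re =
      A ^ 2 + 2 * A * v.re + (v.re ^ 2 - v.im ^ 2) + A + v.re := by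
    simp [pow_two]; ring
  rw [hexp]
  have h₁ : -(2 * A * e) ≤ 2 * A * v.re := by nlinarith
  have h₂ : A * e ≤ A * (A / 8 + 9 * R ^ 2) := by gcongr
  have h₃ : e ^ 2 ≤ (A / 8 + 9 * R ^ 2) ^ 2 := by gcongr
  nlinarith [sq_nonneg (v.re), sq_nonneg (A / 4 - 36 * R ^ 2), sq_nonneg (A / 8 - 9 * R ^ 2),
    sq_nonneg (R ^ 2 - 9 / 2)]

theorem two_mul_le_pow_four (u : ℝ) : 2 * u ≤ u ^ 4 / 2 + 3 / 2 := by
  nlinarith [sq_nonneg (u - 1), sq_nonneg (u ^ 2 - 1)]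

theorem pow_le_factorial_mul_exp (a : ℕ) {u : ℝ} (hu : 0 ≤ u) :
    u ^ a ≤ a.factorial * Real.exp u := by
  have := Real.pow_div_factorial_le_exp u hu a
  rwa [div_le_iff₀' (by positivity)] at this

theorem norm_symb_le (a : ℕ) {m s T R : ℝ} (hm : 0 ≤ m) (hs : 0 < s) (hsT : s ^ 4 ≤ T)
    (hR : 0 ≤ R) {k : ℤ} {w : ℂ} (hw : ‖w - k‖ ≤ R) :
    ‖symb a m (s ^ 4 : ℝ) w‖ ≤ a.factorial * Real.exp (21 * T + 5 / 2) * s⁻¹ ^ a *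
      Real.exp (1460 * R ^ 4 * s ^ 4 - m ^ 2 * s ^ 4 / 2) * Real.exp (-s) ^ k.natAbs := by
  set κ : ℝ := (k.natAbs : ℝ) with hκ
  have hκk : κ = |(k : ℝ)| := by rw [hκ, Nat.cast_natAbs, Int.cast_abs]
  have hκ0 : 0 ≤ κ := by positivity
  have hkn : ‖(k : ℂ)‖ = κ := by rw [hκk, Complex.norm_intCast]
  have hwn : ‖w‖ ≤ κ + R := by
    have := norm_add_le (w - k) k
    rw [sub_add_cancel, hkn] at this
    linarith
  have hv : ‖w ^ 2 - (k : ℂ) ^ 2‖ ≤ 2 * κ * R + R ^ 2 := by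
    have h : w ^ 2 - (k : ℂ) ^ 2 = (w - k) * (w + k) := by ring
    have h' : ‖w + k‖ ≤ 2 * κ + R := by linarith [norm_add_le w k]
    rw [h, norm_mul]
    nlinarith [norm_nonneg (w - k), norm_nonneg (w + k)]
  have hmain := half_sq_le_re_add (A := κ ^ 2 + m) (by linarith) rfl hv
  have hk2 : ((κ : ℂ)) ^ 2 = (k : ℂ) ^ 2 := by
    rw [hκk]; norm_cast; simp
  have hA : (((κ ^ 2 + m : ℝ) : ℂ) + (w ^ 2 - (k : ℂ) ^ 2)) = w ^ 2 + m := by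
    push_cast; rw [hk2]; ring
  rw [hA] at hmain
  have hs4 : 0 < s ^ 4 := by positivity
  have hpow : ‖w‖ ^ a ≤ s⁻¹ ^ a * (a.factorial * Real.exp (κ * s + R * s)) := by
    calc ‖w‖ ^ a ≤ (κ + R) ^ a := by gcongr
      _ = s⁻¹ ^ a * (κ * s + R * s) ^ a := by rw [← mul_pow]; congr 1; field_simp
      _ ≤ _ := by gcongr; exact pow_le_factorial_mul_exp a (by positivity)
  have hexp : ‖Complex.exp (-((w ^ 2 + m) ^ 2 + (w ^ 2 + m)) * (s ^ 4 : ℝ))‖ ≤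
      Real.exp (-((κ ^ 2 + m) ^ 2 / 2 - 1459 * R ^ 4 - 21) * s ^ 4) := by
    rw [Complex.norm_exp, Complex.re_mul_ofReal, Complex.neg_re]
    gcongr
  have hRs : R * s ≤ 1 + R ^ 4 * s ^ 4 := by
    have := two_mul_le_pow_four (R * s)
    have h4 : (R * s) ^ 4 = R ^ 4 * s ^ 4 := by ring
    nlinarith [sq_nonneg (R ^ 2 * s ^ 2 - 1)]
  have hκs : κ * s + κ * s ≤ κ ^ 4 * s ^ 4 / 2 + 3 / 2 := by
    have := two_mul_le_pow_four (κ * s)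
    have h4 : (κ * s) ^ 4 = κ ^ 4 * s ^ 4 := by ring
    linarith
  have hcross : κ ^ 4 * s ^ 4 + m ^ 2 * s ^ 4 ≤ (κ ^ 2 + m) ^ 2 * s ^ 4 := by
    have : 0 ≤ κ ^ 2 * m * s ^ 4 := by positivity
    nlinarith
  rw [symb, norm_mul, norm_pow]
  calc _ ≤ s⁻¹ ^ a * (a.factorial * Real.exp (κ * s + R * s)) *
        Real.exp (-((κ ^ 2 + m) ^ 2 / 2 - 1459 * R ^ 4 - 21) * s ^ 4) := by gcongr
    _ = a.factorial * s⁻¹ ^ a * Real.exp (κ * s + R * s +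
        -((κ ^ 2 + m) ^ 2 / 2 - 1459 * R ^ 4 - 21) * s ^ 4) := by
      rw [Real.exp_add _ (-((κ ^ 2 + m) ^ 2 / 2 - 1459 * R ^ 4 - 21) * s ^ 4)]; ring
    _ ≤ a.factorial * s⁻¹ ^ a * Real.exp ((21 * T + 5 / 2) +
        (1460 * R ^ 4 * s ^ 4 - m ^ 2 * s ^ 4 / 2) + κ * (-s)) := by
      refine mul_le_mul_of_nonneg_left (Real.exp_le_exp.2 ?_) (by positivity)
      linarith
    _ = _ := by
      rw [Real.exp_add, Real.exp_add, ← Real.exp_nat_mul]; ring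

/-- Geometric series over `ℕ` with ratio `e^{-s}`. -/
theorem tsum_exp_neg_pow_le {s : ℝ} (hs : 0 < s) :
    Summable (fun n : ℕ => Real.exp (-s) ^ n) ∧ ∑' n : ℕ, Real.exp (-s) ^ n ≤ (1 + s) * s⁻¹ := by
  have h1 : Real.exp (-s) < 1 := by simpa using hs
  refine ⟨summable_geometric_of_lt_one (Real.exp_pos _).le h1, ?_⟩
  rw [tsum_geometric_of_lt_one (Real.exp_pos _).le h1]
  have h2 : Real.exp (-s) ≤ (1 + s)⁻¹ := by
    rw [Real.exp_neg]
    gcongr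
    linarith [Real.add_one_le_exp s]
  have h3 : s / (1 + s) ≤ 1 - Real.exp (-s) := by
    have : s / (1 + s) = 1 - (1 + s)⁻¹ := by field_simp; ring
    linarith
  calc (1 - Real.exp (-s))⁻¹ ≤ (s / (1 + s))⁻¹ := by gcongr
    _ = _ := by rw [inv_div]; rfl

theorem exists_hasSum_exp_neg_pow_natAbs_le {s : ℝ} (hs : 0 < s) :
    ∃ S ≤ 2 * (1 + s) * s⁻¹, HasSum (fun k : ℤ => Real.exp (-s) ^ k.natAbs) S := by
  obtain ⟨h, hle⟩ := tsum_exp_neg_pow_le hs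
  refine ⟨_, ?_, HasSum.of_nat_of_neg (f := fun k : ℤ => Real.exp (-s) ^ k.natAbs)
    (by simpa using h.hasSum) (by simpa using h.hasSum)⟩
  simp
  linarith

/-- Sum of the one-dimensional Fourier series with symbol `symb`, with stretched-exponential decay
in the distance `r = p³ s⁴`, where `s⁴` is the time. -/
theorem norm_tsum_symb_mul_exp_le (a : ℕ) {m s T p r z : ℝ} (hm : 0 ≤ m) (hs : 0 < s)
    (hsT : s ^ 4 ≤ T) (hp : 0 ≤ p) (hr : r = p ^ 3 * s ^ 4) (hr12 : r < 12)
    (hz : r ≤ 2 * ‖Complex.exp (-(z * Complex.I)) - 1‖) :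
    ‖∑' k : ℤ, symb a m (s ^ 4 : ℝ) k * Complex.exp (k * z * Complex.I)‖ ≤
      a.factorial * Real.exp (21 * T + 7 / 2) * (2 * (2 + T)) * s⁻¹ ^ (a + 1) *
        Real.exp (-(m ^ 2 * s ^ 4) / 2) * Real.exp (-(p * r) / 800) := by
  have hr0 : 0 ≤ r := by rw [hr]; positivity
  obtain ⟨S, hS, hsum⟩ := exists_hasSum_exp_neg_pow_natAbs_le hs
  set N : ℕ := ⌊p * r / 400⌋₊ with hN
  have hNle : (N : ℝ) ≤ p * r / 400 := Nat.floor_le (by positivity)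
  have hNlt : p * r / 400 < N + 1 := Nat.lt_floor_add_one _
  have key : ∀ ρ : ℝ, 1 < ρ → ‖Complex.exp (-(z * Complex.I)) - 1‖ ^ N *
      ‖∑' k : ℤ, symb a m (s ^ 4 : ℝ) k * Complex.exp (k * z * Complex.I)‖ ≤
      (2 / ρ) ^ N * (a.factorial * Real.exp (21 * T + 5 / 2) * s⁻¹ ^ a *
      Real.exp (1460 * (N * ρ) ^ 4 * s ^ 4 - m ^ 2 * s ^ 4 / 2) * S) := fun ρ hρ =>
    norm_tsum_mul_exp_le (differentiable_symb a m _) hρ N (hsum.mul_left _)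
      fun k w hw => norm_symb_le a hm hs hsT (by positivity) hw
  have hmain : ‖∑' k : ℤ, symb a m (s ^ 4 : ℝ) k * Complex.exp (k * z * Complex.I)‖ ≤
      Real.exp (1 - p * r / 400) * (a.factorial * Real.exp (21 * T + 5 / 2) * s⁻¹ ^ a *
      Real.exp (p * r / 800 - m ^ 2 * s ^ 4 / 2) * S) := by
    have hS0 : 0 ≤ S := hsum.nonneg fun k => by positivity
    rcases hr0.eq_or_lt with h0 | h0
    · have hN0 : N = 0 := by rw [hN, ← h0]; simp
      have := key 2 (by norm_num)
      rw [hN0] at this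
      simp only [pow_zero, one_mul, Nat.cast_zero, zero_mul, ne_eq, OfNat.ofNat_ne_zero,
        not_false_eq_true, zero_pow, mul_zero] at this
      rw [← h0, mul_zero, zero_div, zero_div, sub_zero]
      refine this.trans (le_mul_of_one_le_left (by positivity) ?_)
      exact Real.one_le_exp zero_le_one
    · have h := key (12 / r) (by rwa [one_lt_div h0])
      have hpr : p * r = p ^ 4 * s ^ 4 := by rw [hr]; ring
      have hR : N * (12 / r) ≤ 3 / 100 * p := by
        rw [mul_div_assoc', div_le_iff₀ h0]; linarith
      have hR4 : 1460 * (N * (12 / r)) ^ 4 * s ^ 4 ≤ p * r / 800 := by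
        have h4 : (N * (12 / r)) ^ 4 ≤ (3 / 100 * p) ^ 4 := by gcongr
        have : (N * (12 / r)) ^ 4 * s ^ 4 ≤ (3 / 100 * p) ^ 4 * s ^ 4 := by gcongr
        have hps : 0 ≤ p ^ 4 * s ^ 4 := by positivity
        rw [hpr]
        nlinarith
      have hNexp : (1 / 3 : ℝ) ^ N ≤ Real.exp (1 - p * r / 400) := by
        calc (1 / 3 : ℝ) ^ N ≤ Real.exp (-1) ^ N := by
              gcongr
              rw [Real.exp_neg, one_div]
              gcongr
              linarith [Real.exp_one_lt_d9]
          _ = Real.exp (-N) := by rw [← Real.exp_nat_mul]; ring_nf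
          _ ≤ _ := by gcongr; linarith
      have hrN : 0 < (r / 2) ^ N := by positivity
      refine le_of_mul_le_mul_left ?_ hrN
      calc (r / 2) ^ N * ‖∑' k : ℤ, symb a m (s ^ 4 : ℝ) k * Complex.exp (k * z * Complex.I)‖
          ≤ ‖Complex.exp (-(z * Complex.I)) - 1‖ ^ N *
            ‖∑' k : ℤ, symb a m (s ^ 4 : ℝ) k * Complex.exp (k * z * Complex.I)‖ := by
            gcongr; linarith
        _ ≤ _ := h
        _ = (r / 2) ^ N * ((1 / 3) ^ N * (a.factorial * Real.exp (21 * T + 5 / 2) * s⁻¹ ^ a *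
            Real.exp (1460 * (N * (12 / r)) ^ 4 * s ^ 4 - m ^ 2 * s ^ 4 / 2) * S)) := by
          rw [show 2 / (12 / r) = r / 2 * (1 / 3) by field_simp; norm_num, mul_pow, mul_assoc]
        _ ≤ _ := by gcongr
  have hs1 : 1 + s ≤ 2 + T := by
    nlinarith [sq_nonneg (s ^ 2 - 1), sq_nonneg (s - 1)]
  calc _ ≤ _ := hmain
    _ ≤ Real.exp (1 - p * r / 400) * (a.factorial * Real.exp (21 * T + 5 / 2) * s⁻¹ ^ a *
      Real.exp (p * r / 800 - m ^ 2 * s ^ 4 / 2) * (2 * (2 + T) * s⁻¹)) := by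
        gcongr
        exact hS.trans (by gcongr)
    _ = a.factorial * (2 * (2 + T)) * s⁻¹ ^ (a + 1) * (Real.exp (1 - p * r / 400) *
        Real.exp (21 * T + 5 / 2) * Real.exp (p * r / 800 - m ^ 2 * s ^ 4 / 2)) := by ring
    _ = a.factorial * (2 * (2 + T)) * s⁻¹ ^ (a + 1) * (Real.exp (21 * T + 7 / 2) *
        Real.exp (-(m ^ 2 * s ^ 4) / 2) * Real.exp (-(p * r) / 800)) := by
      simp only [← Real.exp_add]; ring_nf
    _ = _ := by ring

theorem norm_exp_neg_mul_I_sub_one (z : ℝ) :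
    ‖Complex.exp (-(z * Complex.I)) - 1‖ = 2 * |Real.sin (z / 2)| := by
  have := Complex.norm_exp_I_mul_ofReal_sub_one (-z)
  push_cast at this
  rw [show -((z : ℂ) * Complex.I) = Complex.I * -z by ring, this]
  simp [neg_div]

theorem abs_sub_le_norm_exp_sub {x y : ℝ} (hx : x ∈ Ioo 0 π) (hy : y ∈ Ioo 0 π) :
    |x - y| ≤ 2 * ‖Complex.exp (-((x - y : ℝ) * Complex.I)) - 1‖ := by
  rw [norm_exp_neg_mul_I_sub_one]
  have hxy : |(x - y) / 2| ≤ π / 2 := by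
    rw [abs_le]; constructor <;> linarith [hx.1, hx.2, hy.1, hy.2]
  have h := Real.mul_abs_le_abs_sin hxy
  rw [abs_div, abs_two] at h
  have hπ : (1 : ℝ) / 2 ≤ 2 / π := by
    rw [div_le_div_iff₀ (by norm_num) Real.pi_pos]; linarith [Real.pi_le_four]
  nlinarith [abs_nonneg (x - y)]

theorem abs_sub_le_norm_exp_add {x y : ℝ} (hx : x ∈ Ioo 0 π) (hy : y ∈ Ioo 0 π) :
    |x - y| ≤ 2 * ‖Complex.exp (-((x + y : ℝ) * Complex.I)) - 1‖ := by
  refine (abs_sub_le_norm_exp_sub hx hy).trans ?_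
  rw [norm_exp_neg_mul_I_sub_one, norm_exp_neg_mul_I_sub_one, sub_div, add_div, Real.sin_sub,
    Real.sin_add]
  have hx1 : 0 ≤ Real.sin (x / 2) :=
    Real.sin_nonneg_of_nonneg_of_le_pi (by linarith [hx.1]) (by linarith [hx.1, hx.2])
  have hy1 : 0 ≤ Real.sin (y / 2) :=
    Real.sin_nonneg_of_nonneg_of_le_pi (by linarith [hy.1]) (by linarith [hy.1, hy.2])
  have hx2 : 0 ≤ Real.cos (x / 2) :=
    Real.cos_nonneg_of_mem_Icc ⟨by linarith [hx.1, Real.pi_pos], by linarith [hx.2]⟩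
  have hy2 : 0 ≤ Real.cos (y / 2) :=
    Real.cos_nonneg_of_mem_Icc ⟨by linarith [hy.1, Real.pi_pos], by linarith [hy.2]⟩
  have h1 := mul_nonneg hx1 hy2
  have h2 := mul_nonneg hx2 hy1
  gcongr 2 * (2 * ?_)
  rw [abs_of_nonneg (add_nonneg h1 h2), abs_le]
  constructor <;> linarith

/-- The `a`-th derivative of the one-dimensional cosine function `eps1 j`. -/
def epsDeriv (a j : ℕ) (x : ℝ) : ℝ :=
  (if j = 0 then 1 / √π else √(2 / π)) * ((j : ℝ) ^ a * Real.cos (j * x + a * (π / 2)))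

theorem epsDeriv_zero (j : ℕ) (x : ℝ) : epsDeriv 0 j x = eps1 j x := by
  unfold epsDeriv eps1; split_ifs with h <;> simp [h]

theorem hasDerivAt_epsDeriv (a j : ℕ) (x : ℝ) :
    HasDerivAt (epsDeriv a j) (epsDeriv (a + 1) j x) x := by
  unfold epsDeriv
  have h : HasDerivAt (fun x : ℝ => (j : ℝ) * x + a * (π / 2)) (j * 1) x :=
    ((hasDerivAt_id x).const_mul _).add_const _
  convert! ((h.cos.const_mul ((j : ℝ) ^ a)).const_mul _) using 1
  have : (j : ℝ) * x + ((a + 1 : ℕ) : ℝ) * (π / 2) = j * x + a * (π / 2) + π / 2 := by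
    push_cast; ring
  rw [this, Real.cos_add_pi_div_two]
  ring

theorem abs_epsDeriv_le (a j : ℕ) (x : ℝ) : |epsDeriv a j x| ≤ (j : ℝ) ^ a := by
  unfold epsDeriv
  have h1 : |if j = 0 then 1 / √π else √(2 / π)| ≤ 1 := by
    split_ifs
    · rw [abs_of_nonneg (by positivity), div_le_one (by positivity), Real.one_le_sqrt]
      linarith [Real.pi_gt_three]
    · rw [abs_of_nonneg (by positivity), Real.sqrt_le_one, div_le_one Real.pi_pos]
      linarith [Real.pi_gt_three]
  rw [abs_mul, abs_mul, abs_of_nonneg (by positivity : (0 : ℝ) ≤ (j : ℝ) ^ a)]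
  have h2 := Real.abs_cos_le_one (j * x + a * (π / 2))
  have h3 : (j : ℝ) ^ a * |Real.cos (j * x + a * (π / 2))| ≤ (j : ℝ) ^ a :=
    mul_le_of_le_one_right (by positivity) h2
  exact (mul_le_of_le_one_left (by positivity) h1).trans h3

/-- The real summand over `ℤ` whose even symmetrization gives the one-dimensional Neumann series. -/
def cosTerm (a : ℕ) (m t x y : ℝ) (k : ℤ) : ℝ :=
  Real.exp (-(((k : ℝ) ^ 2 + m) ^ 2 + ((k : ℝ) ^ 2 + m)) * t) *
    ((k : ℝ) ^ a * Real.cos (k * x + a * (π / 2)) * Real.cos (k * y))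

theorem cosTerm_neg (a : ℕ) (m t x y : ℝ) (k : ℤ) :
    cosTerm a m t x y (-k) = cosTerm a m t x y k := by
  have h : Real.cos (-k * x + a * (π / 2)) = (-1) ^ a * Real.cos (k * x + a * (π / 2)) := by
    rw [← Real.cos_sub_nat_mul_pi, ← Real.cos_neg]
    congr 1
    ring
  have h1 : ((-1 : ℝ) ^ a) * (-1) ^ a = 1 := by rw [← mul_pow]; simp
  unfold cosTerm
  push_cast
  rw [h, neg_mul (k : ℝ) y, Real.cos_neg, neg_sq, neg_pow]
  linear_combination (Real.exp (-(((k : ℝ) ^ 2 + m) ^ 2 + ((k : ℝ) ^ 2 + m)) * t) *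
    ((k : ℝ) ^ a * Real.cos (k * x + a * (π / 2)) * Real.cos (k * y))) * h1

theorem exp_mul_epsDeriv_eq (a : ℕ) (m t x y : ℝ) (l : ℕ) :
    Real.exp (-(((l : ℝ) ^ 2 + m) ^ 2 + ((l : ℝ) ^ 2 + m)) * t) * (epsDeriv a l x * eps1 l y) =
      1 / π * (cosTerm a m t x y l + cosTerm a m t x y (-l) -
        if l = 0 then cosTerm a m t x y 0 else 0) := by
  rw [cosTerm_neg]
  rcases Nat.eq_zero_or_pos l with rfl | h
  · have : (1 / √π) * (1 / √π) = 1 / π := by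
      rw [div_mul_div_comm, Real.mul_self_sqrt Real.pi_pos.le, one_mul]
    simp only [epsDeriv, eps1, cosTerm, if_true, ← this]
    simp
    ring
  · have : √(2 / π) * √(2 / π) = 1 / π * 2 := by
      rw [Real.mul_self_sqrt (by positivity)]; ring
    simp only [epsDeriv, eps1, cosTerm, h.ne', if_false]
    push_cast
    linear_combination Real.exp (-(((l : ℝ) ^ 2 + m) ^ 2 + ((l : ℝ) ^ 2 + m)) * t) *
    ((l : ℝ) ^ a * Real.cos (l * x + a * (π / 2)) * Real.cos (l * y)) * this

theorem cosTerm_eq_re (a : ℕ) (m t x y : ℝ) (k : ℤ) :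
    cosTerm a m t x y k = (Complex.I ^ a / 2 *
      (symb a m t k * Complex.exp (k * (x + y : ℝ) * Complex.I) +
        symb a m t k * Complex.exp (k * (x - y : ℝ) * Complex.I))).re := by
  have hI : Complex.I ^ a = Complex.exp ((a * (π / 2) : ℝ) * Complex.I) := by
    rw [show ((a * (π / 2) : ℝ) : ℂ) * Complex.I = a * (π / 2 * Complex.I) by push_cast; ring,
      Complex.exp_nat_mul, Complex.exp_pi_div_two_mul_I]
  have hs : symb a m t k = (((k : ℝ) ^ a *
      Real.exp (-(((k : ℝ) ^ 2 + m) ^ 2 + ((k : ℝ) ^ 2 + m)) * t) : ℝ) : ℂ) := by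
    unfold symb; push_cast; rfl
  have he : ∀ z : ℝ, Complex.I ^ a * Complex.exp (k * z * Complex.I) =
      Complex.exp ((k * z + a * (π / 2) : ℝ) * Complex.I) := fun z => by
    rw [hI, ← Complex.exp_add]; congr 1; push_cast; ring
  rw [show ∀ s u v : ℂ, Complex.I ^ a / 2 * (s * u + s * v) =
    s * ((1 / 2 : ℝ) * (Complex.I ^ a * u + Complex.I ^ a * v)) from fun s u v => by
      push_cast; ring, he, he, hs, Complex.re_ofReal_mul, Complex.re_ofReal_mul, Complex.add_re,
      Complex.exp_ofReal_mul_I_re, Complex.exp_ofReal_mul_I_re, cosTerm,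
      show (k : ℝ) * (x + y) + a * (π / 2) = (k * x + a * (π / 2)) + k * y by ring,
      show (k : ℝ) * (x - y) + a * (π / 2) = (k * x + a * (π / 2)) - k * y by ring,
      Real.cos_add (k * x + a * (π / 2)), Real.cos_sub (k * x + a * (π / 2))]
  ring

theorem summable_symb_mul_exp (a : ℕ) {m s : ℝ} (hm : 0 ≤ m) (hs : 0 < s) (z : ℝ) :
    Summable (fun k : ℤ => symb a m (s ^ 4 : ℝ) k * Complex.exp (k * z * Complex.I)) := by
  obtain ⟨S, -, hS⟩ := exists_hasSum_exp_neg_pow_natAbs_le hs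
  refine .of_norm_bounded (hS.summable.mul_left (a.factorial * Real.exp (21 * s ^ 4 + 5 / 2) *
    s⁻¹ ^ a * Real.exp (1460 * 0 ^ 4 * s ^ 4 - m ^ 2 * s ^ 4 / 2))) fun k => ?_
  have := Complex.norm_exp_ofReal_mul_I (k * z)
  push_cast at this
  rw [norm_mul, this, mul_one]
  exact norm_symb_le a hm hs le_rfl le_rfl (by simp)

/-- The constant in the one-dimensional kernel bound. -/
def cst (T : ℝ) (a : ℕ) : ℝ :=
  a.factorial * Real.exp (21 * T + 7 / 2) * (2 * (2 + T))

theorem cst_pos {T : ℝ} (hT : 0 < T) (a : ℕ) : 0 < cst T a := by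
  unfold cst; positivity

theorem abs_tsum_exp_mul_epsDeriv_le (a : ℕ) {m s T p x y : ℝ} (hm : 0 ≤ m) (hs : 0 < s)
    (hsT : s ^ 4 ≤ T) (hp : 0 ≤ p) (hr : |x - y| = p ^ 3 * s ^ 4) (hx : x ∈ Ioo 0 π)
    (hy : y ∈ Ioo 0 π) :
    |∑' l : ℕ, Real.exp (-(((l : ℝ) ^ 2 + m) ^ 2 + ((l : ℝ) ^ 2 + m)) * s ^ 4) *
      (epsDeriv a l x * eps1 l y)| ≤ cst T a * s⁻¹ ^ (a + 1) *
        Real.exp (-(m ^ 2 * s ^ 4) / 2) * Real.exp (-(p * |x - y|) / 800) := by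
  have hr12 : |x - y| < 12 := by
    rw [abs_lt]; constructor <;> linarith [hx.1, hx.2, hy.1, hy.2, Real.pi_le_four]
  have h₁ := norm_tsum_symb_mul_exp_le a hm hs hsT hp hr hr12 (abs_sub_le_norm_exp_add hx hy)
  have h₂ := norm_tsum_symb_mul_exp_le a hm hs hsT hp hr hr12 (abs_sub_le_norm_exp_sub hx hy)
  have hsum := Complex.hasSum_re (((summable_symb_mul_exp a hm hs (x + y)).hasSum.add
    (summable_symb_mul_exp a hm hs (x - y)).hasSum).mul_left (Complex.I ^ a / 2))
  simp only [← cosTerm_eq_re] at hsum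
  have hnat := ((hsum.nat_add_neg.sub (hasSum_ite_eq 0 (cosTerm a m (s ^ 4) x y 0))).mul_left
    (1 / π))
  simp only [← exp_mul_epsDeriv_eq] at hnat
  rw [hnat.tsum_eq, add_sub_cancel_right, abs_mul, abs_of_pos (by positivity)]
  have hπ : 1 / π ≤ 1 := by
    rw [div_le_one Real.pi_pos]; linarith [Real.pi_gt_three]
  refine (mul_le_of_le_one_left (abs_nonneg _) hπ).trans ((Complex.abs_re_le_norm _).trans ?_)
  rw [norm_mul, norm_div, norm_pow, Complex.norm_I, one_pow, Complex.norm_two]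
  unfold cst
  linarith [norm_add_le
    (∑' k : ℤ, symb a m (s ^ 4 : ℝ) k * Complex.exp (k * (x + y : ℝ) * Complex.I))
    (∑' k : ℤ, symb a m (s ^ 4 : ℝ) k * Complex.exp (k * (x - y : ℝ) * Complex.I))]

theorem hasSum_prod_fin {n : ℕ} {f : Fin n → ℕ → ℝ} (h0 : ∀ i l, 0 ≤ f i l)
    (hf : ∀ i, Summable (f i)) :
    HasSum (fun k : Fin n → ℕ => ∏ i, f i (k i)) (∏ i, ∑' l, f i l) := by
  induction n with
  | zero => simp
  | succ n ih =>
    have ih' := ih (f := fun i => f i.succ) (fun i => h0 i.succ) (fun i => hf i.succ)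
    have hsum : Summable (fun k : ℕ × (Fin n → ℕ) => f 0 k.1 * ∏ i : Fin n, f i.succ (k.2 i)) :=
      Summable.mul_of_nonneg (f := f 0) (g := fun k : Fin n → ℕ => ∏ i : Fin n, f i.succ (k i))
        (hf 0) ih'.summable (h0 0) fun k => Finset.prod_nonneg fun i _ => h0 i.succ (k i)
    have hmul := HasSum.mul (f := f 0) (g := fun k : Fin n → ℕ => ∏ i : Fin n, f i.succ (k i))
      (hf 0).hasSum ih' hsum
    rw [← (Fin.consEquiv fun _ : Fin (n + 1) => ℕ).hasSum_iff]
    simp only [Function.comp_def, Fin.consEquiv, Equiv.coe_fn_mk, Fin.prod_univ_succ, Fin.cons_zero,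
      Fin.cons_succ]
    exact hmul

/-- A summable majorant for one coordinate of the Fourier series. -/
theorem tsum_pow_mul_exp_le (a : ℕ) {s T : ℝ} (hs : 0 < s) (hsT : s ^ 4 ≤ T) :
    Summable (fun l : ℕ => (l : ℝ) ^ a * Real.exp (-((l : ℝ) ^ 4 * s ^ 4) / 2)) ∧
      ∑' l : ℕ, (l : ℝ) ^ a * Real.exp (-((l : ℝ) ^ 4 * s ^ 4) / 2) ≤
        cst T a * s⁻¹ ^ (a + 1) := by
  obtain ⟨hsum, hle⟩ := tsum_exp_neg_pow_le hs
  have hT : 0 < T := lt_of_lt_of_le (by positivity) hsT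
  have hb : ∀ l : ℕ, (l : ℝ) ^ a * Real.exp (-((l : ℝ) ^ 4 * s ^ 4) / 2) ≤
      a.factorial * Real.exp (3 / 2) * s⁻¹ ^ a * Real.exp (-s) ^ l := fun l => by
    have h1 : (l : ℝ) ^ a ≤ s⁻¹ ^ a * (a.factorial * Real.exp (l * s)) := by
      calc (l : ℝ) ^ a = s⁻¹ ^ a * (l * s) ^ a := by rw [← mul_pow]; congr 1; field_simp
        _ ≤ _ := by gcongr; exact pow_le_factorial_mul_exp a (by positivity)
    have h2 := two_mul_le_pow_four (l * s)
    calc _ ≤ s⁻¹ ^ a * (a.factorial * Real.exp (l * s)) *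
          Real.exp (-((l : ℝ) ^ 4 * s ^ 4) / 2) := by gcongr
      _ = a.factorial * s⁻¹ ^ a * Real.exp (l * s + -((l : ℝ) ^ 4 * s ^ 4) / 2) := by
        rw [Real.exp_add]; ring
      _ ≤ a.factorial * s⁻¹ ^ a * Real.exp (3 / 2 + l * (-s)) := by
        refine mul_le_mul_of_nonneg_left (Real.exp_le_exp.2 ?_) (by positivity)
        rw [mul_pow] at h2
        linarith
      _ = _ := by rw [Real.exp_add, ← Real.exp_nat_mul]; ring
  have hs1 : 1 + s ≤ 2 + T := by
    nlinarith [sq_nonneg (s ^ 2 - 1), sq_nonneg (s - 1)]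
  have hS := hsum.mul_left (a.factorial * Real.exp (3 / 2) * s⁻¹ ^ a)
  have hS' := Summable.of_nonneg_of_le (fun l => by positivity) hb hS
  refine ⟨hS', (hS'.tsum_le_tsum hb hS).trans ?_⟩
  rw [tsum_mul_left]
  calc _ ≤ a.factorial * Real.exp (3 / 2) * s⁻¹ ^ a * ((1 + s) * s⁻¹) := by gcongr
    _ ≤ a.factorial * Real.exp (21 * T + 7 / 2) * s⁻¹ ^ a * ((2 * (2 + T)) * s⁻¹) := by
      gcongr <;> linarith
    _ = _ := by unfold cst; ring

/-- A majorant for the summands of the derivatives of the Green's function. -/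
def majorant {d : ℕ} (a : Fin d → ℕ) (t : ℝ) (k : Fin d → ℕ) : ℝ :=
  Real.exp (-(lam k ^ 2 * t) / 2) * ∏ i, (k i : ℝ) ^ a i

theorem lam_nonneg {d : ℕ} (k : Fin d → ℕ) : 0 ≤ lam k := by
  unfold lam; positivity

theorem majorant_nonneg {d : ℕ} (a : Fin d → ℕ) (t : ℝ) (k : Fin d → ℕ) : 0 ≤ majorant a t k := by
  unfold majorant; positivity

theorem tsum_majorant_le {d : ℕ} (a : Fin d → ℕ) {s T : ℝ} (hs : 0 < s) (hsT : s ^ 4 ≤ T) :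
    Summable (majorant a (s ^ 4)) ∧
      ∑' k, majorant a (s ^ 4) k ≤ ∏ i, (cst T (a i) * s⁻¹ ^ (a i + 1)) := by
  have hsum := hasSum_prod_fin
    (f := fun i (l : ℕ) => (l : ℝ) ^ a i * Real.exp (-((l : ℝ) ^ 4 * s ^ 4) / 2))
    (fun i l => by positivity) (fun i => (tsum_pow_mul_exp_le (a i) hs hsT).1)
  have hb : ∀ k, majorant a (s ^ 4) k ≤
      ∏ i, ((k i : ℝ) ^ a i * Real.exp (-((k i : ℝ) ^ 4 * s ^ 4) / 2)) := fun k => by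
    rw [Finset.prod_mul_distrib, ← Real.exp_sum, majorant, mul_comm]
    refine mul_le_mul_of_nonneg_left (Real.exp_le_exp.2 ?_) (by positivity)
    rw [← Finset.sum_div, Finset.sum_neg_distrib, ← Finset.sum_mul]
    have : ∑ i, (k i : ℝ) ^ 4 ≤ lam k ^ 2 := by
      have := Finset.sum_sq_le_sq_sum_of_nonneg (s := Finset.univ) (f := fun i => (k i : ℝ) ^ 2)
        fun i _ => by positivity
      simpa [← pow_mul, lam] using this
    gcongr
  have hS := Summable.of_nonneg_of_le (majorant_nonneg a _) hb hsum.summable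
  refine ⟨hS, (hS.tsum_le_tsum hb hsum.summable).trans (hsum.tsum_eq.trans_le ?_)⟩
  exact Finset.prod_le_prod (fun i _ => tsum_nonneg fun l => by positivity)
    fun i _ => (tsum_pow_mul_exp_le (a i) hs hsT).2

/-- The summands of the series obtained by differentiating the Green's function termwise. -/
def greenTerm {d : ℕ} (a : Fin d → ℕ) (y : EuclideanSpace ℝ (Fin d)) (t : ℝ) (k : Fin d → ℕ)
    (x : EuclideanSpace ℝ (Fin d)) : ℝ :=
  Real.exp (-(lam k ^ 2 + lam k) * t) * (∏ i, epsDeriv (a i) (k i) (x i)) * epsk k y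

/-- The termwise derivative `∂_x^a G(x, y, t)`. -/
def greenDeriv {d : ℕ} (a : Fin d → ℕ) (y : EuclideanSpace ℝ (Fin d)) (t : ℝ)
    (x : EuclideanSpace ℝ (Fin d)) : ℝ :=
  ∑' k, greenTerm a y t k x

theorem greenDeriv_zero {d : ℕ} (y : EuclideanSpace ℝ (Fin d)) (t : ℝ) :
    greenDeriv 0 y t = fun x => green x y t := by
  ext x
  simp [greenDeriv, greenTerm, green, epsDeriv_zero, epsk]

theorem abs_greenTerm_le {d : ℕ} (a : Fin d → ℕ) (y : EuclideanSpace ℝ (Fin d)) {t : ℝ}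
    (ht : 0 ≤ t) (k : Fin d → ℕ) (x : EuclideanSpace ℝ (Fin d)) :
    |greenTerm a y t k x| ≤ majorant a t k := by
  have h1 : |epsk k y| ≤ 1 := by
    rw [epsk, Finset.abs_prod]
    refine Finset.prod_le_one (fun _ _ => abs_nonneg _) fun i _ => ?_
    rw [← epsDeriv_zero]
    simpa using abs_epsDeriv_le 0 (k i) (y i)
  rw [greenTerm, abs_mul, abs_mul, Real.abs_exp, Finset.abs_prod, majorant]
  refine (mul_le_of_le_one_right (by positivity) h1).trans ?_
  have := lam_nonneg k
  gcongr with i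
  · have h2 := mul_nonneg this ht
    have h3 : 0 ≤ lam k ^ 2 * t := by positivity
    linarith
  · exact abs_epsDeriv_le _ _ _

theorem hasFDerivAt_greenTerm {d : ℕ} (a : Fin d → ℕ) (y : EuclideanSpace ℝ (Fin d)) (t : ℝ)
    (k : Fin d → ℕ) (x : EuclideanSpace ℝ (Fin d)) :
    HasFDerivAt (greenTerm a y t k) (∑ i, greenTerm (a + Pi.single i 1) y t k x •
      (EuclideanSpace.proj i : EuclideanSpace ℝ (Fin d) →L[ℝ] ℝ)) x := by
  have h : ∀ i ∈ Finset.univ, HasFDerivAt (fun x : EuclideanSpace ℝ (Fin d) =>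
      epsDeriv (a i) (k i) (x i)) (epsDeriv (a i + 1) (k i) (x i) •
        (EuclideanSpace.proj i : EuclideanSpace ℝ (Fin d) →L[ℝ] ℝ)) x := fun i _ =>
    HasDerivAt.comp_hasFDerivAt (h₂ := epsDeriv (a i) (k i))
      (f := (EuclideanSpace.proj i : EuclideanSpace ℝ (Fin d) →L[ℝ] ℝ)) x
      (hasDerivAt_epsDeriv (a i) (k i) (x i)) (ContinuousLinearMap.hasFDerivAt _)
  have := ((HasFDerivAt.finsetProd h).const_mul (Real.exp (-(lam k ^ 2 + lam k) * t))).mul_const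
    (epsk k y)
  refine this.congr_fderiv ?_
  simp only [Finset.smul_sum, smul_smul]
  refine Finset.sum_congr rfl fun i _ => ?_
  congr 1
  rw [greenTerm, ← Finset.mul_prod_erase Finset.univ _ (Finset.mem_univ i)]
  have : ∏ j ∈ Finset.univ.erase i, epsDeriv ((a + Pi.single i 1 : Fin d → ℕ) j) (k j) (x j) =
      ∏ j ∈ Finset.univ.erase i, epsDeriv (a j) (k j) (x j) :=
    Finset.prod_congr rfl fun j hj => by simp [Finset.ne_of_mem_erase hj]
  rw [this]
  simp
  ring

theorem summable_majorant {d : ℕ} (a : Fin d → ℕ) {t : ℝ} (ht : 0 < t) :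
    Summable (majorant a t) := by
  have h4 : (t ^ (1 / 4 : ℝ)) ^ 4 = t := by
    rw [← Real.rpow_natCast, ← Real.rpow_mul ht.le]; norm_num
  have := (tsum_majorant_le a (Real.rpow_pos_of_pos ht (1 / 4)) le_rfl).1
  rwa [h4] at this

theorem hasFDerivAt_greenDeriv {d : ℕ} (a : Fin d → ℕ) (y : EuclideanSpace ℝ (Fin d)) {t : ℝ}
    (ht : 0 < t) (x : EuclideanSpace ℝ (Fin d)) :
    HasFDerivAt (greenDeriv a y t) (∑ i, greenDeriv (a + Pi.single i 1) y t x •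
      (EuclideanSpace.proj i : EuclideanSpace ℝ (Fin d) →L[ℝ] ℝ)) x := by
  have hs : ∀ a : Fin d → ℕ, Summable fun k => greenTerm a y t k x := fun a =>
    .of_norm_bounded (summable_majorant a ht) fun k => abs_greenTerm_le a y ht.le k x
  have hu : Summable fun k => ∑ i, majorant (a + Pi.single i 1) t k *
      ‖(EuclideanSpace.proj i : EuclideanSpace ℝ (Fin d) →L[ℝ] ℝ)‖ :=
    summable_sum fun i _ => (summable_majorant _ ht).mul_right _
  have hle : ∀ (k : Fin d → ℕ) (x : EuclideanSpace ℝ (Fin d)),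
      ‖∑ i, greenTerm (a + Pi.single i 1) y t k x •
        (EuclideanSpace.proj i : EuclideanSpace ℝ (Fin d) →L[ℝ] ℝ)‖ ≤
      ∑ i, majorant (a + Pi.single i 1) t k *
        ‖(EuclideanSpace.proj i : EuclideanSpace ℝ (Fin d) →L[ℝ] ℝ)‖ := fun k x => by
    refine (norm_sum_le _ _).trans (Finset.sum_le_sum fun i _ => ?_)
    rw [norm_smul]
    exact mul_le_mul_of_nonneg_right (abs_greenTerm_le _ y ht.le k x) (norm_nonneg _)
  refine (hasFDerivAt_tsum hu (hasFDerivAt_greenTerm a y t) hle (hs a) x).congr_fderiv ?_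
  rw [Summable.tsum_finsetSum fun i _ => (hs _).smul_const _]
  exact Finset.sum_congr rfl fun i _ => (hs _).tsum_smul_const _

theorem pder_greenDeriv {d : ℕ} (a : Fin d → ℕ) (y : EuclideanSpace ℝ (Fin d)) {t : ℝ}
    (ht : 0 < t) (i : Fin d) :
    pder i (greenDeriv a y t) = greenDeriv (a + Pi.single i 1) y t := by
  ext x
  rw [pder, (hasFDerivAt_greenDeriv a y ht x).fderiv]
  simp [PiLp.single_apply]

theorem abs_greenDeriv_le_exp_coord {n : ℕ} (a : Fin (n + 1) → ℕ) {s T p : ℝ} (hs : 0 < s)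
    (hsT : s ^ 4 ≤ T) (hp : 0 ≤ p) {x y : EuclideanSpace ℝ (Fin (n + 1))} (hx : x ∈ domD (n + 1))
    (hy : y ∈ domD (n + 1)) (i : Fin (n + 1)) (hr : |x i - y i| = p ^ 3 * s ^ 4) :
    |greenDeriv a y (s ^ 4) x| ≤ (∏ j, cst T (a j)) * s⁻¹ ^ (n + 1 + ∑ j, a j) *
      Real.exp (-(p * |x i - y i|) / 800) := by
  have hs4 : 0 < s ^ 4 := by positivity
  have hT : 0 < T := hs4.trans_le hsT
  set a' : Fin n → ℕ := fun j => a (i.succAbove j) with ha'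
  set Q : (Fin n → ℕ) → ℝ := fun k' => (∏ j, epsDeriv (a' j) (k' j) (x (i.succAbove j))) *
    ∏ j, eps1 (k' j) (y (i.succAbove j)) with hQ
  set P : (Fin n → ℕ) → ℕ → ℝ := fun k' l =>
    Real.exp (-(((l : ℝ) ^ 2 + lam k') ^ 2 + ((l : ℝ) ^ 2 + lam k')) * s ^ 4) *
      (epsDeriv (a i) l (x i) * eps1 l (y i)) with hP
  have hQle : ∀ k', |Q k'| ≤ ∏ j, (k' j : ℝ) ^ a' j := fun k' => by
    rw [hQ]
    simp only [abs_mul, Finset.abs_prod]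
    refine (mul_le_of_le_one_right (Finset.prod_nonneg fun _ _ => abs_nonneg _)
      (Finset.prod_le_one (fun _ _ => abs_nonneg _) fun j _ => ?_)).trans
      (Finset.prod_le_prod (fun _ _ => abs_nonneg _) fun j _ => abs_epsDeriv_le _ _ _)
    rw [← epsDeriv_zero]
    simpa using abs_epsDeriv_le 0 (k' j) (y (i.succAbove j))
  have hterm : ∀ (l : ℕ) (k' : Fin n → ℕ),
      greenTerm a y (s ^ 4) (i.insertNth l k' : Fin (n + 1) → ℕ) x = P k' l * Q k' := fun l k' => by
    have hlam : lam (i.insertNth l k' : Fin (n + 1) → ℕ) = (l : ℝ) ^ 2 + lam k' := by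
      simp [lam, Fin.sum_univ_succAbove _ i]
    rw [greenTerm, epsk, hlam, Fin.prod_univ_succAbove _ i, Fin.prod_univ_succAbove _ i, hP, hQ]
    simp only [Fin.insertNth_apply_same, Fin.insertNth_apply_succAbove]
    ring
  have hsum : Summable fun k => greenTerm a y (s ^ 4) k x :=
    .of_norm_bounded (summable_majorant a hs4) fun k => abs_greenTerm_le a y hs4.le k x
  have hsum' : Summable fun q : ℕ × (Fin n → ℕ) => P q.2 q.1 * Q q.2 := by
    simpa only [Function.comp_def, Fin.insertNthEquiv, Equiv.coe_fn_mk, hterm] using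
      (Fin.insertNthEquiv (fun _ => ℕ) i).summable_iff.2 hsum
  have hG : greenDeriv a y (s ^ 4) x = ∑' k' : Fin n → ℕ, (∑' l : ℕ, P k' l) * Q k' := by
    have h₁ : greenDeriv a y (s ^ 4) x = ∑' q : ℕ × (Fin n → ℕ), P q.2 q.1 * Q q.2 := by
      rw [greenDeriv, ← (Fin.insertNthEquiv (fun _ : Fin (n + 1) => ℕ) i).tsum_eq]
      exact tsum_congr fun q => hterm q.1 q.2
    have h₂ : Summable fun q : (Fin n → ℕ) × ℕ => P q.1 q.2 * Q q.1 :=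
      (Equiv.prodComm (Fin n → ℕ) ℕ).summable_iff.2 hsum'
    rw [h₁, ← (Equiv.prodComm (Fin n → ℕ) ℕ).tsum_eq]
    refine Eq.trans h₂.tsum_prod (tsum_congr fun k' => ?_)
    exact tsum_mul_right (f := P k') (a := Q k')
  obtain ⟨hm, hmle⟩ := tsum_majorant_le a' hs hsT
  set E := Real.exp (-(p * |x i - y i|) / 800) with hE
  have hb : ∀ k' : Fin n → ℕ, ‖(∑' l : ℕ, P k' l) * Q k'‖ ≤
      cst T (a i) * s⁻¹ ^ (a i + 1) * E * majorant a' (s ^ 4) k' := fun k' => by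
    have h1 := abs_tsum_exp_mul_epsDeriv_le (a i) (lam_nonneg k') hs hsT hp hr (hx i) (hy i)
    have hc := cst_pos hT (a i)
    rw [Real.norm_eq_abs, abs_mul, majorant]
    calc _ ≤ cst T (a i) * s⁻¹ ^ (a i + 1) * Real.exp (-(lam k' ^ 2 * s ^ 4) / 2) * E *
          ∏ j, (k' j : ℝ) ^ a' j := mul_le_mul h1 (hQle k') (abs_nonneg _) (by positivity)
      _ = _ := by ring
  rw [hG, ← Real.norm_eq_abs]
  refine (tsum_of_norm_bounded (hm.hasSum.mul_left _) hb).trans ?_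
  have hc := cst_pos hT (a i)
  calc _ ≤ cst T (a i) * s⁻¹ ^ (a i + 1) * E * ∏ j, (cst T (a' j) * s⁻¹ ^ (a' j + 1)) := by gcongr
    _ = (∏ j, (cst T (a j) * s⁻¹ ^ (a j + 1))) * E := by
      rw [Fin.prod_univ_succAbove _ i]; ring
    _ = _ := by
      rw [Finset.prod_mul_distrib, Finset.prod_pow_eq_pow_sum, Finset.sum_add_distrib]
      simp [add_comm]

theorem exists_norm_le_card_mul_abs {n : ℕ} (v : EuclideanSpace ℝ (Fin (n + 1))) :
    ∃ i, ‖v‖ ≤ (n + 1 : ℝ) * |v i| := by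
  obtain ⟨i, hi⟩ := Finite.exists_max fun i => |v i|
  refine ⟨i, ?_⟩
  rw [EuclideanSpace.norm_eq]
  refine Real.sqrt_le_iff.2 ⟨by positivity, ?_⟩
  calc ∑ j, ‖v j‖ ^ 2 ≤ ∑ _j : Fin (n + 1), |v i| ^ 2 := by
        gcongr with j; exact hi j
    _ = (n + 1 : ℝ) * 1 * |v i| ^ 2 := by simp
    _ ≤ (n + 1 : ℝ) * (n + 1) * |v i| ^ 2 := by
        gcongr; linarith [(Nat.cast_nonneg n : (0 : ℝ) ≤ n)]
    _ = _ := by ring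

/-- Stretched-exponential bound for an arbitrary derivative of the Green's function. -/
theorem abs_greenDeriv_le {n : ℕ} (a : Fin (n + 1) → ℕ) {T t : ℝ} (ht : t ∈ Ioc 0 T)
    {x y : EuclideanSpace ℝ (Fin (n + 1))} (hx : x ∈ domD (n + 1)) (hy : y ∈ domD (n + 1)) :
    |greenDeriv a y t x| ≤ (∏ j, cst T (a j)) *
      t ^ (-(((n + 1 : ℕ) : ℝ) + (∑ j, a j : ℕ)) / 4) *
      Real.exp (-(1 / (800 * (n + 1 : ℝ) ^ 2)) * ‖x - y‖ ^ ((4 : ℝ) / 3) *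
        t ^ (-(1 : ℝ) / 3)) := by
  have ht0 : 0 < t := ht.1
  have hT : 0 < T := ht0.trans_le ht.2
  obtain ⟨i, hi⟩ := exists_norm_le_card_mul_abs (x - y)
  rw [PiLp.sub_apply] at hi
  set r := |x i - y i| with hr
  have hr0 : 0 ≤ r := abs_nonneg _
  set s : ℝ := t ^ (1 / 4 : ℝ) with hs
  have hs0 : 0 < s := Real.rpow_pos_of_pos ht0 _
  have hs4 : s ^ 4 = t := by
    rw [hs, ← Real.rpow_natCast, ← Real.rpow_mul ht0.le]; norm_num
  set p : ℝ := (r / t) ^ (1 / 3 : ℝ) with hp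
  have hp3 : r = p ^ 3 * s ^ 4 := by
    rw [hs4, hp, ← Real.rpow_natCast, ← Real.rpow_mul (by positivity)]
    norm_num
    field_simp
  have hpr : p * r = r ^ (4 / 3 : ℝ) * t ^ (-(1 : ℝ) / 3) := by
    rw [hp, Real.div_rpow hr0 ht0.le, show (4 / 3 : ℝ) = 1 / 3 + 1 by norm_num,
      Real.rpow_add_one' hr0 (by norm_num), neg_div, Real.rpow_neg ht0.le]
    ring
  have hpow : ‖x - y‖ ^ ((4 : ℝ) / 3) ≤ (n + 1 : ℝ) ^ 2 * r ^ (4 / 3 : ℝ) := by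
    calc ‖x - y‖ ^ ((4 : ℝ) / 3) ≤ ((n + 1 : ℝ) * r) ^ ((4 : ℝ) / 3) := by gcongr
      _ = (n + 1 : ℝ) ^ ((4 : ℝ) / 3) * r ^ ((4 : ℝ) / 3) := Real.mul_rpow (by positivity) hr0
      _ ≤ (n + 1 : ℝ) ^ (2 : ℝ) * r ^ ((4 : ℝ) / 3) := by
        gcongr
        · linarith [(Nat.cast_nonneg n : (0 : ℝ) ≤ n)]
        · norm_num
      _ = _ := by rw [Real.rpow_two]
  have hmain := abs_greenDeriv_le_exp_coord a hs0 (hs4.le.trans ht.2)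
    (by positivity : 0 ≤ p) hx hy i hp3
  rw [hs4] at hmain
  have hspow : s⁻¹ ^ (n + 1 + ∑ j, a j) = t ^ (-(((n + 1 : ℕ) : ℝ) + (∑ j, a j : ℕ)) / 4) := by
    rw [hs, ← Real.rpow_neg ht0.le, ← Real.rpow_natCast, ← Real.rpow_mul ht0.le]
    congr 1
    push_cast
    ring
  rw [hspow] at hmain
  refine hmain.trans ?_
  have hc : 0 ≤ ∏ j, cst T (a j) := Finset.prod_nonneg fun j _ => (cst_pos hT _).le
  refine mul_le_mul_of_nonneg_left (Real.exp_le_exp.2 ?_) (by positivity)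
  rw [← hr, hpr]
  have hn : (0 : ℝ) < (n + 1 : ℝ) ^ 2 := by positivity
  have : 1 / (800 * (n + 1 : ℝ) ^ 2) * ‖x - y‖ ^ ((4 : ℝ) / 3) * t ^ (-(1 : ℝ) / 3) ≤
      1 / (800 * (n + 1 : ℝ) ^ 2) * ((n + 1 : ℝ) ^ 2 * r ^ (4 / 3 : ℝ)) * t ^ (-(1 : ℝ) / 3) := by
    gcongr
  have h2 : 1 / (800 * (n + 1 : ℝ) ^ 2) * ((n + 1 : ℝ) ^ 2 * r ^ (4 / 3 : ℝ)) *
      t ^ (-(1 : ℝ) / 3) = r ^ (4 / 3 : ℝ) * t ^ (-(1 : ℝ) / 3) / 800 := by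
    field_simp
  linarith

/-- Gaussian-type upper bounds for the first and second order spatial derivatives of the
Green's function: for every `T > 0` there are `c₁, c₂ > 0` such that for `t ∈ (0,T]`,
`x, y ∈ D` and every multi-index `a` with `|a| ∈ {1,2}` (i.e. `∂_i` or `∂_i ∂_j`),
the derivative `∂_x^a G(x,y,t)` exists and
`|∂_x^a G(x,y,t)| ≤ c₁ t^{−(d+|a|)/4} exp(−c₂ |x−y|^{4/3} t^{−1/3})`. -/
theorem statement4 (d : ℕ) (hd : d = 1 ∨ d = 2 ∨ d = 3) (T : ℝ) (hT : 0 < T) :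
    ∃ c₁ > (0 : ℝ), ∃ c₂ > (0 : ℝ), ∀ t ∈ Set.Ioc (0 : ℝ) T,
      ∀ x ∈ domD d, ∀ y ∈ domD d,
        (∀ i : Fin d,
          DifferentiableAt ℝ (fun x' => green x' y t) x ∧
          |pder i (fun x' => green x' y t) x| ≤
            c₁ * t ^ (-((d : ℝ) + 1) / 4) *
              Real.exp (-c₂ * ‖x - y‖ ^ ((4 : ℝ) / 3) * t ^ (-(1 : ℝ) / 3))) ∧
        (∀ i j : Fin d,
          DifferentiableAt ℝ (pder j (fun x' => green x' y t)) x ∧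
          |pder i (pder j (fun x' => green x' y t)) x| ≤
            c₁ * t ^ (-((d : ℝ) + 2) / 4) *
              Real.exp (-c₂ * ‖x - y‖ ^ ((4 : ℝ) / 3) * t ^ (-(1 : ℝ) / 3))) := by
  obtain ⟨n, rfl⟩ : ∃ n, d = n + 1 := ⟨d - 1, by omega⟩
  set C : (Fin (n + 1) → ℕ) → ℝ := fun a => ∏ j, cst T (a j)
  have hC : ∀ a, 0 < C a := fun a => Finset.prod_pos fun j _ => cst_pos hT _
  set e : Fin (n + 1) → Fin (n + 1) → ℕ := fun i => 0 + Pi.single i 1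
  set c₁ : ℝ := ∑ i, C (e i) + ∑ j, ∑ i, C (e j + Pi.single i 1)
  have h₁ : ∀ i, C (e i) ≤ c₁ := fun i => by
    have := Finset.single_le_sum (f := fun i => C (e i)) (fun i _ => (hC _).le)
      (Finset.mem_univ i)
    have h0 : 0 ≤ ∑ j, ∑ i, C (e j + Pi.single i 1) :=
      Finset.sum_nonneg fun j _ => Finset.sum_nonneg fun i _ => (hC _).le
    simp only [c₁]
    linarith
  have h₂ : ∀ i j, C (e j + Pi.single i 1) ≤ c₁ := fun i j => by
    have h := Finset.single_le_sum (f := fun i => C (e j + Pi.single i 1))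
      (fun i _ => (hC _).le) (Finset.mem_univ i)
    have h' := Finset.single_le_sum (f := fun j => ∑ i, C (e j + Pi.single i 1))
      (fun j _ => Finset.sum_nonneg fun i _ => (hC _).le) (Finset.mem_univ j)
    have h0 : 0 ≤ ∑ i, C (e i) := Finset.sum_nonneg fun i _ => (hC _).le
    simp only [c₁]
    linarith
  refine ⟨c₁, (hC _).trans_le (h₁ 0), 1 / (800 * (n + 1 : ℝ) ^ 2), by positivity,
    fun t ht x hx y hy => ?_⟩
  have hp : 0 < t := ht.1
  rw [← greenDeriv_zero]
  refine ⟨fun i => ⟨(hasFDerivAt_greenDeriv _ y hp x).differentiableAt, ?_⟩, fun i j => ?_⟩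
  · rw [pder_greenDeriv _ _ hp]
    have hsum : ∑ l, e i l = 1 := by simp [e]
    have := abs_greenDeriv_le (e i) ht hx hy
    rw [hsum, Nat.cast_one] at this
    refine this.trans ?_
    gcongr
    exact h₁ i
  · rw [pder_greenDeriv _ _ hp, pder_greenDeriv _ _ hp]
    refine ⟨(hasFDerivAt_greenDeriv _ y hp x).differentiableAt, ?_⟩
    have hsum : ∑ l, (e j + Pi.single i 1 : Fin (n + 1) → ℕ) l = 2 := by
      simp [e, Finset.sum_add_distrib]
    have := abs_greenDeriv_le (e j + Pi.single i 1) ht hx hy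
    rw [hsum, Nat.cast_two] at this
    refine this.trans ?_
    gcongr
    exact h₂ i j
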